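/- Let G = (V,E) be a triangle-free finite simple graph. Then for any set S ⊆ E, the partition (S, E \ S) is an STC-labeling of G if and only if S is a matching of G. In particular, the maximum number of strong edges in an STC-labeling of a triangle-free graph equals its maximum matching size. -/

import Mathlib

/-- An STC-labeling of a simple graph `G`, given by its set `S` of strong edges
(the weak edges are `G.edgeSet \ S`). -/
def IsSTCLabeling {V : Type*} (G : SimpleGraph V) (S : Set (Sym2 V)) : Prop :=
  S ⊆ G.edgeSet ∧ ∀ u v w : V, s(u, v) ∈ S → s(v, w) ∈ S → u ≠ w → G.Adj u w

/-- A matching of `G`: a set of edges of `G` that are pairwise disjoint. -/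
def IsMatchingSet {V : Type*} (G : SimpleGraph V) (M : Set (Sym2 V)) : Prop :=
  M ⊆ G.edgeSet ∧ M.Pairwise (fun e f => ∀ v : V, v ∈ e → v ∉ f)

/-- In a triangle-free graph, a set `S ⊆ E` of strong edges is an STC-labeling iff
it is a matching; in particular the maximum number of strong edges of an
STC-labeling equals the maximum matching size. -/
theorem triangle_free_stc_iff_matching {V : Type*} [Fintype V]
    (G : SimpleGraph V) (htf : G.CliqueFree 3) :
    (∀ S : Set (Sym2 V), S ⊆ G.edgeSet →
      (IsSTCLabeling G S ↔ IsMatchingSet G S)) ∧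
    sSup {n : ℕ | ∃ S : Set (Sym2 V), IsSTCLabeling G S ∧ S.ncard = n} =
      sSup {n : ℕ | ∃ M : Set (Sym2 V), IsMatchingSet G M ∧ M.ncard = n} := by
  have key : ∀ S : Set (Sym2 V), IsSTCLabeling G S ↔ IsMatchingSet G S := by
    intro S
    constructor
    · rintro ⟨hS, h⟩
      refine ⟨hS, ?_⟩
      intro e he f hf hne v hve hvf
      obtain ⟨u, rfl⟩ := hve
      obtain ⟨w, rfl⟩ := hvf
      have huw : u ≠ w := fun h => hne (by rw [h])
      have h1 : G.Adj v u := hS he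
      have h2 : G.Adj v w := hS hf
      have h3 : G.Adj u w := h u v w (by rwa [Sym2.eq_swap]) hf huw
      classical
      exact htf {v, u, w} (SimpleGraph.is3Clique_triple_iff.2 ⟨h1, h2, h3⟩)
    · rintro ⟨hS, h⟩
      refine ⟨hS, ?_⟩
      intro u v w h1 h2 huw
      have hne : s(u, v) ≠ s(v, w) := by
        intro heq
        rw [Sym2.eq_swap] at heq
        exact huw (Sym2.congr_right.1 heq)
      exact absurd (Sym2.mem_mk_left v w) (h h1 h2 hne v (Sym2.mem_mk_right u v))
  exact ⟨fun S _ => key S, by simp only [key]⟩
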